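/- (Beta posterior tail bound) Let α, β > 0, n ∈ ℕ, 0 ≤ k ≤ n, with k + α ≥ 2 and n − k + β ≥ 2. Let θ be distributed according to Beta(k + α, n − k + β), and set μ := (k+α)/(n+α+β). Then for every ε > 0, P(|θ − μ| ≥ ε) ≤ [1.25·(n+α+β−2)^{3/2} / √((k+α−1)(n−k+β−1))] · e^{−2(n+α+β−2)ε²}. -/

import Mathlib

open MeasureTheory

/-- The Beta function `B(a,b) = Γ(a)Γ(b)/Γ(a+b)`. -/
noncomputable def betaFn (a b : ℝ) : ℝ := Real.Gamma a * Real.Gamma b / Real.Gamma (a + b)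

/-- The density of the `Beta(a,b)` distribution on `[0,1]`: `x^{a−1}(1−x)^{b−1}/B(a,b)`. -/
noncomputable def betaPDF (a b x : ℝ) : ℝ :=
  if 0 ≤ x ∧ x ≤ 1 then x ^ (a - 1) * (1 - x) ^ (b - 1) / betaFn a b else 0

/-- The `Beta(a,b)` probability measure on `ℝ` (supported on `[0,1]`). -/
noncomputable def betaMeasure (a b : ℝ) : Measure ℝ :=
  volume.withDensity fun x => ENNReal.ofReal (betaPDF a b x)

lemma betaMeasure_eq_probabilityTheory_betaMeasure (a b : ℝ) :
    betaMeasure a b = ProbabilityTheory.betaMeasure a b := by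
  refine withDensity_congr_ae ?_
  filter_upwards [Measure.ae_ne volume (0 : ℝ), Measure.ae_ne volume (1 : ℝ)] with x h0 h1
  have hiff : (0 ≤ x ∧ x ≤ 1) ↔ (0 < x ∧ x < 1) :=
    and_congr ⟨fun h => h.lt_of_ne' h0, le_of_lt⟩ ⟨fun h => h.lt_of_ne h1, le_of_lt⟩
  simp only [betaPDF, ProbabilityTheory.betaPDF, ProbabilityTheory.betaPDFReal, hiff,
    betaFn, ProbabilityTheory.beta]
  congr 2
  ring

lemma isProbabilityMeasure_betaMeasure {a b : ℝ} (ha : 0 < a) (hb : 0 < b) :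
    IsProbabilityMeasure (betaMeasure a b) := by
  rw [betaMeasure_eq_probabilityTheory_betaMeasure]
  exact ProbabilityTheory.isProbabilityMeasureBeta ha hb

lemma measurable_betaPDF (a b : ℝ) : Measurable (betaPDF a b) :=
  Measurable.ite measurableSet_Icc (by fun_prop) (by fun_prop)

lemma betaPDF_nonneg {a b : ℝ} (ha : 0 < a) (hb : 0 < b) (x : ℝ) : 0 ≤ betaPDF a b x := by
  unfold betaPDF
  split_ifs with h
  · have : 0 < betaFn a b := ProbabilityTheory.beta_pos ha hb
    have := Real.rpow_nonneg h.1 (a - 1)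
    have := Real.rpow_nonneg (sub_nonneg.2 h.2) (b - 1)
    positivity
  · rfl

lemma ae_betaMeasure_mem_Icc (a b : ℝ) : ∀ᵐ x ∂betaMeasure a b, x ∈ Set.Icc (0 : ℝ) 1 := by
  rw [betaMeasure, ae_withDensity_iff (measurable_betaPDF a b).ennreal_ofReal]
  refine .of_forall fun x hx => ?_
  contrapose! hx
  simp [betaPDF, Set.mem_Icc.not.1 hx]

lemma integral_betaMeasure {a b : ℝ} (ha : 0 < a) (hb : 0 < b) (f : ℝ → ℝ) :
    ∫ x, f x ∂betaMeasure a b =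
      (∫ x in (0 : ℝ)..1, x ^ (a - 1) * (1 - x) ^ (b - 1) * f x) / betaFn a b := by
  rw [betaMeasure, integral_withDensity_eq_integral_toReal_smul
    (measurable_betaPDF a b).ennreal_ofReal (by simp),
    intervalIntegral.integral_of_le zero_le_one, ← integral_Icc_eq_integral_Ioc,
    ← integral_indicator measurableSet_Icc, ← integral_div]
  congr 1 with x
  rw [ENNReal.toReal_ofReal (betaPDF_nonneg ha hb x)]
  by_cases h : x ∈ Set.Icc (0 : ℝ) 1
  · rw [Set.indicator_of_mem h, betaPDF, if_pos (Set.mem_Icc.1 h), smul_eq_mul]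
    ring
  · rw [Set.indicator_of_notMem h, betaPDF, if_neg (Set.mem_Icc.not.1 h)]
    simp

lemma integrable_betaMeasure_of_continuous {a b : ℝ} (ha : 0 < a) (hb : 0 < b) {f : ℝ → ℝ}
    (hf : Continuous f) : Integrable f (betaMeasure a b) := by
  have := isProbabilityMeasure_betaMeasure ha hb
  obtain ⟨C, hC⟩ := (isCompact_Icc (a := (0 : ℝ)) (b := 1)).exists_bound_of_continuousOn
    hf.continuousOn
  refine Integrable.of_bound hf.aestronglyMeasurable C ?_
  filter_upwards [ae_betaMeasure_mem_Icc a b] with x hx using hC x hx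

/-- Stein's identity for the Beta distribution. -/
lemma integral_betaMeasure_stein {a b : ℝ} (ha : 1 ≤ a) (hb : 1 ≤ b) {f f' : ℝ → ℝ}
    (hf : ∀ x, HasDerivAt f (f' x) x) (hf' : Continuous f') :
    ∫ x, ((a + b) * x - a) * f x ∂betaMeasure a b =
      ∫ x, x * (1 - x) * f' x ∂betaMeasure a b := by
  have ha0 : 0 < a := by linarith
  have hb0 : 0 < b := by linarith
  have hfc : Continuous f := continuous_iff_continuousAt.2 fun x => (hf x).continuousAt
  have hc1 : Continuous fun x : ℝ => x ^ (a - 1) :=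
    Real.continuous_rpow_const (by linarith)
  have hc2 : Continuous fun x : ℝ => (1 - x) ^ (b - 1) :=
    (Real.continuous_rpow_const (by linarith)).comp (by fun_prop)
  rw [← sub_eq_zero, ← integral_sub
    (integrable_betaMeasure_of_continuous ha0 hb0 (by fun_prop))
    (integrable_betaMeasure_of_continuous ha0 hb0 (by fun_prop)), integral_betaMeasure ha0 hb0]
  have hderiv : ∀ x ∈ Set.uIcc (0 : ℝ) 1,
      HasDerivAt (fun x : ℝ => -(x ^ a * (1 - x) ^ b * f x))
        (x ^ (a - 1) * (1 - x) ^ (b - 1) * (((a + b) * x - a) * f x - x * (1 - x) * f' x)) x := by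
    intro x hx
    rw [Set.uIcc_of_le zero_le_one] at hx
    have h1 : HasDerivAt (fun x : ℝ => x ^ a) (a * x ^ (a - 1)) x :=
      Real.hasDerivAt_rpow_const (Or.inr ha)
    have h2 : HasDerivAt (fun x : ℝ => (1 - x) ^ b) (-1 * b * (1 - x) ^ (b - 1)) x :=
      ((hasDerivAt_id x).const_sub 1).rpow_const (Or.inr hb)
    have e1 : x ^ a = x ^ (a - 1) * x := by
      rw [← Real.rpow_add_one' hx.1 (by linarith), sub_add_cancel]
    have e2 : (1 - x) ^ b = (1 - x) ^ (b - 1) * (1 - x) := by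
      rw [← Real.rpow_add_one' (sub_nonneg.2 hx.2) (by linarith), sub_add_cancel]
    convert! ((h1.mul h2).mul (hf x)).neg using 1
    rw [Pi.mul_apply, e1, e2]
    ring
  rw [intervalIntegral.integral_eq_sub_of_hasDerivAt hderiv
    (Continuous.intervalIntegrable (by fun_prop) _ _)]
  simp [Real.zero_rpow ha0.ne', Real.zero_rpow hb0.ne']

lemma le_apply_zero_of_mul_deriv_nonpos {g g' : ℝ → ℝ} (hg : ∀ t, HasDerivAt g (g' t) t)
    (hg' : ∀ t, t * g' t ≤ 0) (t : ℝ) : g t ≤ g 0 := by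
  have hc : Continuous g := continuous_iff_continuousAt.2 fun x => (hg x).continuousAt
  rcases le_total 0 t with ht | ht
  · refine antitoneOn_of_hasDerivWithinAt_nonpos (convex_Ici 0) hc.continuousOn
      (fun x _ => (hg x).hasDerivWithinAt) (fun x hx => ?_) Set.self_mem_Ici ht ht
    rw [interior_Ici] at hx
    exact nonpos_of_mul_nonpos_right (hg' x) hx
  · refine monotoneOn_of_hasDerivWithinAt_nonneg (convex_Iic 0) hc.continuousOn
      (fun x _ => (hg x).hasDerivWithinAt) (fun x hx => ?_) ht Set.self_mem_Iic ht
    rw [interior_Iic] at hx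
    have hx' : x < 0 := hx
    nlinarith [hg' x]

/-- The centred `Beta(a,b)` distribution is sub-Gaussian with variance proxy `1 / (4(a+b))`. -/
lemma hasSubgaussianMGF_betaMeasure {a b : ℝ} (ha : 1 ≤ a) (hb : 1 ≤ b) :
    ProbabilityTheory.HasSubgaussianMGF (fun x => x - a / (a + b))
      (Real.toNNReal (1 / (4 * (a + b)))) (betaMeasure a b) := by
  have ha0 : 0 < a := by linarith
  have hb0 : 0 < b := by linarith
  have hs : 0 < a + b := by linarith
  have := isProbabilityMeasure_betaMeasure ha0 hb0
  set X : ℝ → ℝ := fun x => x - a / (a + b) with hX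
  have hint : ∀ t, Integrable (fun x => Real.exp (t * X x)) (betaMeasure a b) := fun t =>
    integrable_betaMeasure_of_continuous ha0 hb0 (by fun_prop)
  refine ⟨hint, fun t => ?_⟩
  rw [Real.coe_toNNReal _ (by positivity)]
  set M := ProbabilityTheory.mgf X (betaMeasure a b) with hM
  have hset : ProbabilityTheory.integrableExpSet X (betaMeasure a b) = Set.univ :=
    Set.eq_univ_of_forall hint
  have hMderiv : ∀ t, HasDerivAt M (∫ x, X x * Real.exp (t * X x) ∂betaMeasure a b) t := fun t =>
    ProbabilityTheory.hasDerivAt_mgf (by simp [hset])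
  have hstein : ∀ t, (a + b) * ∫ x, X x * Real.exp (t * X x) ∂betaMeasure a b =
      t * ∫ x, x * (1 - x) * Real.exp (t * X x) ∂betaMeasure a b := by
    intro t
    have hd : ∀ x, HasDerivAt (fun x => Real.exp (t * X x)) (t * Real.exp (t * X x)) x := by
      intro x
      convert! (((hasDerivAt_id x).sub_const (a / (a + b))).const_mul t).exp using 1
      simp [hX, mul_comm]
    have h := integral_betaMeasure_stein ha hb hd (by fun_prop)
    rw [← integral_const_mul, ← integral_const_mul]
    convert! h using 3 with x x
    · simp only [hX]
      field_simp
    · ring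
  have hquarter : ∀ t, ∫ x, x * (1 - x) * Real.exp (t * X x) ∂betaMeasure a b ≤ M t / 4 := by
    intro t
    rw [hM, ProbabilityTheory.mgf, ← integral_div]
    refine integral_mono (integrable_betaMeasure_of_continuous ha0 hb0 (by fun_prop))
      ((hint t).div_const 4) fun x => ?_
    have := Real.exp_pos (t * X x)
    nlinarith [mul_nonneg (sq_nonneg (x - 1 / 2)) this.le]
  have key := le_apply_zero_of_mul_deriv_nonpos
    (g := fun t => M t * Real.exp (-(1 / (4 * (a + b)) * t ^ 2 / 2)))
    (g' := fun t => (∫ x, X x * Real.exp (t * X x) ∂betaMeasure a b) *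
        Real.exp (-(1 / (4 * (a + b)) * t ^ 2 / 2)) +
      M t * (Real.exp (-(1 / (4 * (a + b)) * t ^ 2 / 2)) * (-(1 / (4 * (a + b)) * t))))
    (fun t => (hMderiv t).mul (HasDerivAt.exp (by
      convert! (((hasDerivAt_pow 2 t).const_mul (1 / (4 * (a + b)))).div_const 2).neg using 1
      simp
      ring))) ?_ t
  · have h0 : M 0 = 1 := by simp [hM]
    simp only [h0] at key
    rw [Real.exp_neg, ← div_eq_mul_inv, div_le_iff₀ (Real.exp_pos _)] at key
    simpa using key
  · intro t
    have hI : ∫ x, X x * Real.exp (t * X x) ∂betaMeasure a b =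
        t * (∫ x, x * (1 - x) * Real.exp (t * X x) ∂betaMeasure a b) / (a + b) := by
      rw [← hstein t, mul_div_cancel_left₀ _ hs.ne']
    have : t * ((∫ x, X x * Real.exp (t * X x) ∂betaMeasure a b) *
        Real.exp (-(1 / (4 * (a + b)) * t ^ 2 / 2)) +
      M t * (Real.exp (-(1 / (4 * (a + b)) * t ^ 2 / 2)) * (-(1 / (4 * (a + b)) * t)))) =
      -(t ^ 2 / (a + b) * Real.exp (-(1 / (4 * (a + b)) * t ^ 2 / 2)) *
        (M t / 4 - ∫ x, x * (1 - x) * Real.exp (t * X x) ∂betaMeasure a b)) := by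
      rw [hI]
      field_simp
      ring
    rw [this, neg_nonpos]
    have := sub_nonneg.2 (hquarter t)
    positivity

lemma betaMeasure_real_abs_sub_ge_le {a b : ℝ} (ha : 1 ≤ a) (hb : 1 ≤ b) {ε : ℝ} (hε : 0 ≤ ε) :
    (betaMeasure a b).real {x : ℝ | |x - a / (a + b)| ≥ ε} ≤
      2 * Real.exp (-2 * (a + b) * ε ^ 2) := by
  have := isProbabilityMeasure_betaMeasure (show 0 < a by linarith) (show 0 < b by linarith)
  have hs : 0 < a + b := by linarith
  have hsub := hasSubgaussianMGF_betaMeasure ha hb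
  have hc : -ε ^ 2 / (2 * (Real.toNNReal (1 / (4 * (a + b))) : ℝ)) = -2 * (a + b) * ε ^ 2 := by
    rw [Real.coe_toNNReal _ (by positivity)]
    field_simp
    ring
  have h1 := hsub.measure_ge_le hε
  have h2 := hsub.neg.measure_ge_le hε
  rw [hc] at h1 h2
  have hset : {x : ℝ | |x - a / (a + b)| ≥ ε} = {x : ℝ | ε ≤ x - a / (a + b)} ∪
      {x : ℝ | ε ≤ (-fun x : ℝ => x - a / (a + b)) x} := by
    ext x
    simp [le_abs]
  rw [hset]
  linarith [measureReal_union_le (μ := betaMeasure a b) {x : ℝ | ε ≤ x - a / (a + b)}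
    {x : ℝ | ε ≤ (-fun x : ℝ => x - a / (a + b)) x}]

lemma two_le_mul_rpow_div_sqrt_mul {p q : ℝ} (hp : 1 ≤ p) (hq : 1 ≤ q) :
    2 ≤ 1.25 * (p + q) ^ ((3 : ℝ) / 2) / Real.sqrt (p * q) := by
  have hpq : 0 < p * q := by positivity
  rw [le_div_iff₀ (Real.sqrt_pos.2 hpq)]
  have h1 : Real.sqrt (p * q) ≤ (p + q) / 2 := by
    rw [Real.sqrt_le_left (by linarith)]
    nlinarith [sq_nonneg (p - q)]
  have h2 : p + q ≤ (p + q) ^ ((3 : ℝ) / 2) :=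
    Real.self_le_rpow_of_one_le (by linarith) (by norm_num)
  linarith

/-- **Beta posterior tail bound.** Let `α, β > 0`, `0 ≤ k ≤ n`, with `k + α ≥ 2` and
`n − k + β ≥ 2`.  Let `θ ∼ Beta(k + α, n − k + β)` and `μ := (k+α)/(n+α+β)`.  Then for every
`ε > 0`,
`P(|θ − μ| ≥ ε) ≤ [1.25·(n+α+β−2)^{3/2} / √((k+α−1)(n−k+β−1))] · e^{−2(n+α+β−2)ε²}`. -/
theorem beta_posterior_tail_bound (α β : ℝ) (hα : 0 < α) (hβ : 0 < β)
    (n k : ℕ) (hk : k ≤ n) (h1 : 2 ≤ (k : ℝ) + α) (h2 : 2 ≤ (n : ℝ) - (k : ℝ) + β)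
    (ε : ℝ) (hε : 0 < ε) :
    betaMeasure ((k : ℝ) + α) ((n : ℝ) - (k : ℝ) + β)
        {x : ℝ | |x - ((k : ℝ) + α) / ((n : ℝ) + α + β)| ≥ ε} ≤
      ENNReal.ofReal
        (1.25 * ((n : ℝ) + α + β - 2) ^ ((3 : ℝ) / 2) /
            Real.sqrt (((k : ℝ) + α - 1) * ((n : ℝ) - (k : ℝ) + β - 1)) *
          Real.exp (-2 * ((n : ℝ) + α + β - 2) * ε ^ 2)) := by
  have hmean : ((k : ℝ) + α) / ((n : ℝ) + α + β) =
      ((k : ℝ) + α) / (((k : ℝ) + α) + ((n : ℝ) - (k : ℝ) + β)) := by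
    congr 1
    ring
  have hsum : (n : ℝ) + α + β - 2 = ((k : ℝ) + α - 1) + ((n : ℝ) - (k : ℝ) + β - 1) := by ring
  rw [hmean, hsum]
  set a := (k : ℝ) + α
  set b := (n : ℝ) - (k : ℝ) + β
  have := isProbabilityMeasure_betaMeasure (show 0 < a by linarith) (show 0 < b by linarith)
  have hC := two_le_mul_rpow_div_sqrt_mul (show 1 ≤ a - 1 by linarith) (show 1 ≤ b - 1 by linarith)
  refine (ENNReal.le_ofReal_iff_toReal_le (measure_ne_top _ _)
    (mul_nonneg (zero_le_two.trans hC) (Real.exp_pos _).le)).2 ?_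
  refine (betaMeasure_real_abs_sub_ge_le (by linarith) (by linarith) hε.le).trans ?_
  refine mul_le_mul hC (Real.exp_le_exp.2 ?_) (Real.exp_pos _).le (zero_le_two.trans hC)
  nlinarith [sq_nonneg ε]
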